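/- General integral of the Jacobi equation for a double elementary divisor (Theorem 12.12): Let λ₁ ∈ ℝ with eigenvector θ₁ = (α₁, β₁, γ₁) ∈ ℝ³ (A·θ₁ = λ₁·θ₁) and first generalized eigenvector θ₁⁽¹⁾ = (α₁⁽¹⁾, β₁⁽¹⁾, γ₁⁽¹⁾) ∈ ℝ³ with (A − λ₁·I)·θ₁⁽¹⁾ = θ₁, and let λ₃ ∈ ℝ with eigenvector θ₃ = (α₃, β₃, γ₃) ∈ ℝ³ (A·θ₃ = λ₃·θ₃). Set p₁(x,y) := α₁·x + β₁·y + γ₁, p₁⁽¹⁾(x,y) := α₁⁽¹⁾·x + β₁⁽¹⁾·y + γ₁⁽¹⁾, and p₃(x,y) := α₃·x + β₃·y + γ₃. Then the function F(x,y) := (p₁(x,y)/p₃(x,y))·exp((λ₃ − λ₁)·p₁⁽¹⁾(x,y)/p₁(x,y)) satisfies 𝔍F(x,y) = 0 at every (x,y) ∈ ℝ² with p₁(x,y) ≠ 0 and p₃(x,y) ≠ 0. -/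

import Mathlib

/-- The Fréchet derivative of the affine function `α·x + β·y + γ` on the plane. -/
theorem hasFDerivAt_affine_plane (α β γ : ℝ) (z : ℝ × ℝ) :
    HasFDerivAt (fun z : ℝ × ℝ => α * z.1 + β * z.2 + γ)
      (α • ContinuousLinearMap.fst ℝ ℝ ℝ + β • ContinuousLinearMap.snd ℝ ℝ ℝ) z :=
  ((hasFDerivAt_fst.const_mul α).add (hasFDerivAt_snd.const_mul β)).add_const γ

/-- If along `v` the logarithmic derivatives of `p` and `r` are `m - l` and `n - l`, and `q`
is a generalized companion of `p`, then `(p / r) * exp ((n - m) * (q / p))` is stationary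
along `v`. -/
theorem fderiv_div_mul_exp_eq_zero {E : Type*} [NormedAddCommGroup E] [NormedSpace ℝ E]
    {p q r : E → ℝ} {p' q' r' : E →L[ℝ] ℝ} {z v : E} {m n l : ℝ}
    (hp : HasFDerivAt p p' z) (hq : HasFDerivAt q q' z) (hr : HasFDerivAt r r' z)
    (hp0 : p z ≠ 0) (hr0 : r z ≠ 0)
    (hpv : p' v = (m - l) * p z) (hqv : q' v = (m - l) * q z + p z)
    (hrv : r' v = (n - l) * r z) :
    fderiv ℝ (fun w => p w / r w * Real.exp ((n - m) * (q w / p w))) z v = 0 := by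
  have hpi := (hasDerivAt_inv hp0).comp_hasFDerivAt z hp
  have hri := (hasDerivAt_inv hr0).comp_hasFDerivAt z hr
  have h := (hp.mul hri).mul ((hq.mul hpi).const_mul (n - m)).exp
  simp only [div_eq_mul_inv]
  refine (DFunLike.congr_fun h.fderiv v).trans ?_
  simp [hpv, hqv, hrv]
  field_simp
  ring

/-- General integral of the Jacobi equation for a double elementary divisor
(Theorem 12.12): with `A·θ₁ = lam₁·θ₁`, `(A − lam₁·I)·θ₁⁽¹⁾ = θ₁` and
`A·θ₃ = lam₃·θ₃`, the function `(p₁/p₃)·exp ((lam₃ − lam₁)·p₁⁽¹⁾/p₁)` is a general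
integral at every point where `p₁ ≠ 0` and `p₃ ≠ 0`. -/
theorem jacobi_general_integral_double_divisor
    (a₁ a₂ a₃ b₁ b₂ b₃ c₁ c₂ c₃ : ℝ) (lam₁ lam₃ : ℝ)
    (α₁ β₁ γ₁ α₁' β₁' γ₁' α₃ β₃ γ₃ : ℝ)
    (hev₁ : (!![a₁, a₂, a₃; b₁, b₂, b₃; c₁, c₂, c₃]).mulVec ![α₁, β₁, γ₁] =
      lam₁ • ![α₁, β₁, γ₁])
    (hgen : ((!![a₁, a₂, a₃; b₁, b₂, b₃; c₁, c₂, c₃]) -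
        lam₁ • (1 : Matrix (Fin 3) (Fin 3) ℝ)).mulVec ![α₁', β₁', γ₁'] = ![α₁, β₁, γ₁])
    (hev₃ : (!![a₁, a₂, a₃; b₁, b₂, b₃; c₁, c₂, c₃]).mulVec ![α₃, β₃, γ₃] =
      lam₃ • ![α₃, β₃, γ₃]) :
    ∀ x y : ℝ,
      α₁ * x + β₁ * y + γ₁ ≠ 0 →
      α₃ * x + β₃ * y + γ₃ ≠ 0 →
      fderiv ℝ (fun z : ℝ × ℝ =>
          (α₁ * z.1 + β₁ * z.2 + γ₁) / (α₃ * z.1 + β₃ * z.2 + γ₃) *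
            Real.exp ((lam₃ - lam₁) *
              ((α₁' * z.1 + β₁' * z.2 + γ₁') / (α₁ * z.1 + β₁ * z.2 + γ₁)))) (x, y)
          ((a₁ * x + b₁ * y + c₁) - x * (a₃ * x + b₃ * y + c₃),
           (a₂ * x + b₂ * y + c₂) - y * (a₃ * x + b₃ * y + c₃)) = 0 := by
  intro x y h₁ h₃
  simp only [Matrix.sub_mulVec, Matrix.smul_mulVec, Matrix.one_mulVec] at hgen
  have e₁ := congrFun hev₁
  have e₂ := congrFun hgen
  have e₃ := congrFun hev₃
  simp [Fin.forall_fin_succ, Matrix.mulVec, dotProduct, Fin.sum_univ_succ] at e₁ e₂ e₃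
  obtain ⟨e₁₁, e₁₂, e₁₃⟩ := e₁
  obtain ⟨e₂₁, e₂₂, e₂₃⟩ := e₂
  obtain ⟨e₃₁, e₃₂, e₃₃⟩ := e₃
  refine fderiv_div_mul_exp_eq_zero (l := a₃ * x + b₃ * y + c₃)
    (hasFDerivAt_affine_plane α₁ β₁ γ₁ (x, y)) (hasFDerivAt_affine_plane α₁' β₁' γ₁' (x, y))
    (hasFDerivAt_affine_plane α₃ β₃ γ₃ (x, y)) h₁ h₃ ?_ ?_ ?_
  · simp
    linear_combination x * e₁₁ + y * e₁₂ + e₁₃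
  · simp
    linear_combination x * e₂₁ + y * e₂₂ + e₂₃
  · simp
    linear_combination x * e₃₁ + y * e₃₂ + e₃₃
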